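/- arXiv:1304.0463 — 5 statements merged into one kernel-verified Lean document; each statement's English description precedes it below -/
import Mathlib

section
/- Suppose (a i j) is a family of structure coefficients (homogeneous of degrees m i − m j + 1 and satisfying the structure identity). Then the map δ is a type D structure: (μ ⊗ id_N) ∘ (id_A ⊗ δ) ∘ δ + (d ⊗ ε_N) ∘ δ = 0 as an R-linear map N → A ⊗[R] N. -/
open TensorProduct

noncomputable section

/-- The sign `(-1)^j` for an integer `j`. -/
def zsign (j : ℤ) : ℤ := (((-1 : ℤˣ) ^ j : ℤˣ) : ℤ)

/-- The collapse map `A ⊗ (A ⊗ M) → A ⊗ M`, i.e. `(μ ⊗ id)` after reassociation. -/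
def mu2 (R A M : Type*) [CommRing R] [Ring A] [Algebra R A]
    [AddCommGroup M] [Module R M] :
    A ⊗[R] (A ⊗[R] M) →ₗ[R] A ⊗[R] M :=
  (TensorProduct.map (LinearMap.mul' R A) (LinearMap.id : M →ₗ[R] M)) ∘ₗ
    (TensorProduct.assoc R A A M).symm.toLinearMap

/-- The composition `f ∗ g = (μ ⊗ id) ∘ (id_A ⊗ f) ∘ g` of type-D-style maps. -/
def dstar {R A : Type*} [CommRing R] [Ring A] [Algebra R A]
    {M₁ M₂ M₃ : Type*} [AddCommGroup M₁] [Module R M₁]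
    [AddCommGroup M₂] [Module R M₂] [AddCommGroup M₃] [Module R M₃]
    (f : M₂ →ₗ[R] A ⊗[R] M₃) (g : M₁ →ₗ[R] A ⊗[R] M₂) :
    M₁ →ₗ[R] A ⊗[R] M₃ :=
  mu2 R A M₃ ∘ₗ LinearMap.lTensor A f ∘ₗ g


theorem mu2_tmul_tmul {R A M : Type*} [CommRing R] [Ring A] [Algebra R A]
    [AddCommGroup M] [Module R M] (α β : A) (x : M) :
    mu2 R A M (α ⊗ₜ[R] (β ⊗ₜ[R] x)) = (α * β) ⊗ₜ[R] x := by
  simp [mu2]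

/-- the structure coefficients make `δ` a type `D` structure:
`(μ ⊗ id_N) ∘ (id_A ⊗ δ) ∘ δ + (d ⊗ ε_N) ∘ δ = 0`. -/
theorem typeD_of_structure_coefficients
    {R A : Type*} [CommRing R] [Ring A] [Algebra R A]
    (𝒜 : ℤ → Submodule R A) [GradedAlgebra 𝒜]
    (d : A →ₗ[R] A) (hd1 : d 1 = 0)
    (hLeib : ∀ (j : ℤ) (α β : A), β ∈ 𝒜 j →
      d (α * β) = zsign j • (d α * β) + α * d β)
    (n : ℕ) (hn : 2 ≤ n) (m : Fin n → ℤ) (a : Fin n → Fin n → A)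
    (ha : ∀ i j, a i j ∈ 𝒜 (m i - m j + 1))
    (hstruct : ∀ i k, zsign (m k) • d (a i k) + ∑ j, a i j * a j k = 0)
    (δ : (Fin n → R) →ₗ[R] A ⊗[R] (Fin n → R))
    (hδ : ∀ i, δ (Pi.basisFun R (Fin n) i) =
      ∑ j, a i j ⊗ₜ[R] (Pi.basisFun R (Fin n) j : Fin n → R))
    (ε : (Fin n → R) →ₗ[R] (Fin n → R))
    (hε : ∀ i, ε (Pi.basisFun R (Fin n) i) =
      zsign (m i) • (Pi.basisFun R (Fin n) i : Fin n → R)) :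
    dstar δ δ + (TensorProduct.map d ε) ∘ₗ δ = 0 := by
  refine (Pi.basisFun R (Fin n)).ext fun i => ?_
  simp only [LinearMap.add_apply, dstar, LinearMap.comp_apply, hδ, map_sum,
    LinearMap.lTensor_tmul, TensorProduct.tmul_sum, mu2_tmul_tmul, TensorProduct.map_tmul, hε,
    LinearMap.zero_apply]
  rw [Finset.sum_comm, ← Finset.sum_add_distrib]
  refine Finset.sum_eq_zero fun k _ => ?_
  rw [← TensorProduct.sum_tmul, TensorProduct.tmul_smul, TensorProduct.smul_tmul',
    ← TensorProduct.add_tmul, add_comm, hstruct, TensorProduct.zero_tmul]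

end
end

section
/- Cancellation for type D structures (structure identity for the reduced coefficients): suppose (a i j) is a family of structure coefficients with a i i = 0 for all i, a 1 2 = 1 (the unit of A), and m 2 = m 1 + 1, and set ā i j = a i j − a i 2 * a 1 j for 3 ≤ i, j ≤ n. Then each ā i j lies in 𝒜 (m i − m j + 1), and the reduced coefficients satisfy the structure identity on the index set {3, …, n}: for all 3 ≤ i, k ≤ n, (-1)^(m k) • d (ā i k) + ∑_{j=3}^{n} (ā i j * ā j k) = 0. In particular, δ̄ (x̄ i) = ∑_{j=3}^{n} (ā i j) ⊗ (x̄ j) defines a type D structure on the free R-module N̄ with basis x̄ 3, …, x̄ n. -/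
open TensorProduct

noncomputable section

theorem zsign_add (i j : ℤ) : zsign (i + j) = zsign i * zsign j := by
  simp [zsign, zpow_add]

/-- Cancelling the arrow `p → q` with unit coefficient preserves the structure identity, where the
sum still runs over the full index set. -/
theorem reduced_structure_identity {R A ι : Type*} [CommRing R] [Ring A] [Algebra R A] [Fintype ι]
    (𝒜 : ℤ → Submodule R A) (d : A →ₗ[R] A) (hd1 : d 1 = 0)
    (hLeib : ∀ (j : ℤ) (α β : A), β ∈ 𝒜 j →
      d (α * β) = zsign j • (d α * β) + α * d β)
    (m : ι → ℤ) (a : ι → ι → A) (ha : ∀ i j, a i j ∈ 𝒜 (m i - m j + 1))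
    (hstruct : ∀ i k, zsign (m k) • d (a i k) + ∑ j, a i j * a j k = 0)
    {p q : ι} (hpq : a p q = 1) (hm : m q = m p + 1) (i k : ι) :
    zsign (m k) • d (a i k - a i q * a p k)
      + ∑ j, (a i j - a i q * a p j) * (a j k - a j q * a p k) = 0 := by
  have hsign : zsign (m k) * zsign (m p - m k + 1) = zsign (m q) := by
    rw [← zsign_add, hm]
    congr 1
    ring
  have hik := hstruct i k
  have hiq := hstruct i q
  have hpk := hstruct p k
  have hsq : ∑ j, a p j * a j q = 0 := by
    simpa [hpq, hd1] using hstruct p q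
  have hsum : ∑ j, (a i j - a i q * a p j) * (a j k - a j q * a p k)
      = ∑ j, a i j * a j k - (∑ j, a i j * a j q) * a p k
        - a i q * (∑ j, a p j * a j k) + a i q * (∑ j, a p j * a j q) * a p k := by
    simp only [Finset.sum_mul, Finset.mul_sum, ← Finset.sum_sub_distrib, ← Finset.sum_add_distrib]
    exact Finset.sum_congr rfl fun j _ => by noncomm_ring
  rw [hsum, hsq, ← neg_eq_of_add_eq_zero_right hik, ← neg_eq_of_add_eq_zero_right hiq,
    ← neg_eq_of_add_eq_zero_right hpk, map_sub, hLeib _ _ _ (ha p k), smul_sub, smul_add,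
    smul_smul, hsign, ← mul_smul_comm, ← smul_mul_assoc]
  noncomm_ring

/-- A family of coefficients satisfying the structure identity defines a type `D` structure on the
free module. -/
theorem dstar_add_map_comp_eq_zero {R A ι : Type*} [CommRing R] [Ring A] [Algebra R A] [Fintype ι]
    (d : A →ₗ[R] A) (m : ι → ℤ) (a : ι → ι → A)
    (hstruct : ∀ i k, zsign (m k) • d (a i k) + ∑ j, a i j * a j k = 0)
    (δ : (ι → R) →ₗ[R] A ⊗[R] (ι → R)) (ε : (ι → R) →ₗ[R] (ι → R))
    (hδ : ∀ i, δ (Pi.basisFun R ι i) = ∑ j, a i j ⊗ₜ[R] (Pi.basisFun R ι j : ι → R))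
    (hε : ∀ i, ε (Pi.basisFun R ι i) = zsign (m i) • (Pi.basisFun R ι i : ι → R)) :
    dstar δ δ + TensorProduct.map d ε ∘ₗ δ = 0 := by
  refine (Pi.basisFun R ι).ext fun i => ?_
  have hstar : dstar δ δ (Pi.basisFun R ι i)
      = ∑ k, (∑ j, a i j * a j k) ⊗ₜ[R] (Pi.basisFun R ι k : ι → R) := by
    simp only [dstar, mu2, LinearMap.comp_apply, hδ, map_sum, LinearMap.lTensor_tmul,
      TensorProduct.tmul_sum, LinearEquiv.coe_coe, TensorProduct.assoc_symm_tmul,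
      TensorProduct.map_tmul, LinearMap.mul'_apply, LinearMap.id_apply, TensorProduct.sum_tmul]
    exact Finset.sum_comm
  have hmap : TensorProduct.map d ε (δ (Pi.basisFun R ι i))
      = ∑ k, (zsign (m k) • d (a i k)) ⊗ₜ[R] (Pi.basisFun R ι k : ι → R) := by
    rw [hδ, map_sum]
    exact Finset.sum_congr rfl fun k _ => by
      rw [TensorProduct.map_tmul, hε, TensorProduct.tmul_smul, TensorProduct.smul_tmul']
  rw [LinearMap.add_apply, hstar, LinearMap.comp_apply, hmap, ← Finset.sum_add_distrib]
  refine Finset.sum_eq_zero fun k _ => ?_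
  rw [← TensorProduct.add_tmul, add_comm, hstruct, TensorProduct.zero_tmul]

/-- cancellation, structure identity for the reduced coefficients:
if `a i i = 0` for all `i`, `a 1 2 = 1`, and `m 2 = m 1 + 1`, and
`ā i j = a i j − a i 2 * a 1 j`, then each `ā i j` (for `i, j ≥ 3`) lies in
`𝒜 (m i − m j + 1)`, the reduced coefficients satisfy the structure identity
on the index set `{3, …, n}`, and consequently
`δ̄ (x̄ i) = ∑_{j ≥ 3} ā i j ⊗ x̄ j` defines a type `D` structure on the free
module `N̄` with basis `x̄ 3, …, x̄ n`.
(Paper indices `1, 2` correspond to the Lean indices `⟨0,_⟩, ⟨1,_⟩` of `Fin n`,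
and `j ≥ 3` to `2 ≤ (j : ℕ)`.) -/
theorem cancellation_structure_identity
    {R A : Type*} [CommRing R] [Ring A] [Algebra R A]
    (𝒜 : ℤ → Submodule R A) [GradedAlgebra 𝒜]
    (d : A →ₗ[R] A) (hd1 : d 1 = 0)
    (hLeib : ∀ (j : ℤ) (α β : A), β ∈ 𝒜 j →
      d (α * β) = zsign j • (d α * β) + α * d β)
    (n : ℕ) (hn : 2 ≤ n) (m : Fin n → ℤ) (a : Fin n → Fin n → A)
    (ha : ∀ i j, a i j ∈ 𝒜 (m i - m j + 1))
    (hstruct : ∀ i k, zsign (m k) • d (a i k) + ∑ j, a i j * a j k = 0)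
    (haii : ∀ i, a i i = 0)
    (ha12 : a ⟨0, by omega⟩ ⟨1, by omega⟩ = 1)
    (hm : m ⟨1, by omega⟩ = m ⟨0, by omega⟩ + 1)
    (abar : Fin n → Fin n → A)
    (habar : ∀ i j, abar i j = a i j - a i ⟨1, by omega⟩ * a ⟨0, by omega⟩ j) :
    (∀ i j : Fin n, 2 ≤ (i : ℕ) → 2 ≤ (j : ℕ) → abar i j ∈ 𝒜 (m i - m j + 1)) ∧
    (∀ i k : Fin n, 2 ≤ (i : ℕ) → 2 ≤ (k : ℕ) →
      zsign (m k) • d (abar i k)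
        + ∑ j ∈ Finset.univ.filter (fun j : Fin n => 2 ≤ (j : ℕ)),
            abar i j * abar j k = 0) ∧
    (∀ (δbar : ({j : Fin n // 2 ≤ (j : ℕ)} → R) →ₗ[R]
          A ⊗[R] ({j : Fin n // 2 ≤ (j : ℕ)} → R))
       (εbar : ({j : Fin n // 2 ≤ (j : ℕ)} → R) →ₗ[R]
          ({j : Fin n // 2 ≤ (j : ℕ)} → R)),
      (∀ i : {j : Fin n // 2 ≤ (j : ℕ)},
        δbar (Pi.basisFun R {j : Fin n // 2 ≤ (j : ℕ)} i) =
          ∑ j : {j : Fin n // 2 ≤ (j : ℕ)},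
            abar i.1 j.1 ⊗ₜ[R]
              (Pi.basisFun R {j : Fin n // 2 ≤ (j : ℕ)} j
                : {j : Fin n // 2 ≤ (j : ℕ)} → R)) →
      (∀ i : {j : Fin n // 2 ≤ (j : ℕ)},
        εbar (Pi.basisFun R {j : Fin n // 2 ≤ (j : ℕ)} i) =
          zsign (m i.1) • (Pi.basisFun R {j : Fin n // 2 ≤ (j : ℕ)} i
            : {j : Fin n // 2 ≤ (j : ℕ)} → R)) →
      dstar δbar δbar + (TensorProduct.map d εbar) ∘ₗ δbar = 0) := by
  have hid : ∀ i k : Fin n, 2 ≤ (i : ℕ) → 2 ≤ (k : ℕ) →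
      zsign (m k) • d (abar i k)
        + ∑ j ∈ Finset.univ.filter (fun j : Fin n => 2 ≤ (j : ℕ)),
            abar i j * abar j k = 0 := by
    intro i k _ _
    have key := reduced_structure_identity 𝒜 d hd1 hLeib m a ha hstruct ha12 hm i k
    simp only [← habar] at key
    rw [Finset.sum_filter_of_ne, key]
    intro j _ hj
    by_contra hlt
    apply hj
    obtain h | h : (j : ℕ) = 0 ∨ (j : ℕ) = 1 := by omega
    · have hj' : j = ⟨0, by omega⟩ := Fin.ext h
      rw [hj', habar _ k, ha12, one_mul, sub_self, mul_zero]
    · have hj' : j = ⟨1, by omega⟩ := Fin.ext h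
      rw [hj', habar i, ha12, mul_one, sub_self, zero_mul]
  refine ⟨fun i j _ _ => ?_, hid, fun δbar εbar hδ hε => ?_⟩
  · rw [habar]
    refine Submodule.sub_mem _ (ha i j) ?_
    convert SetLike.mul_mem_graded (ha i ⟨1, by omega⟩) (ha ⟨0, by omega⟩ j) using 2
    rw [hm]
    ring
  · refine dstar_add_map_comp_eq_zero d (fun i => m i.1) (fun i j => abar i.1 j.1)
      (fun i k => ?_) δbar εbar hδ hε
    rw [← hid i.1 k.1 i.2 k.2]
    congr 1
    exact (Finset.sum_subtype _ (by simp) fun j => abar i.1 j * abar j k.1).symm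

end
end

section
/- With the cancellation data, ι is a D-structure morphism from (N̄, δ̄) to (N, δ): (μ ⊗ id_N) ∘ (id_A ⊗ δ) ∘ ι − (μ ⊗ id_N) ∘ (id_A ⊗ ι) ∘ δ̄ + (d ⊗ ε_N) ∘ ι = 0 as R-linear maps N̄ → A ⊗[R] N. -/
open TensorProduct

noncomputable section

@[simp]
theorem mu2_tmul {R A M : Type*} [CommRing R] [Ring A] [Algebra R A]
    [AddCommGroup M] [Module R M] (x y : A) (v : M) :
    mu2 R A M (x ⊗ₜ[R] (y ⊗ₜ[R] v)) = (x * y) ⊗ₜ[R] v := by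
  simp [mu2]

theorem zsign_add_one (j : ℤ) : zsign (j + 1) = -zsign j := by
  simp [zsign, zpow_add]

/-- Splitting off the first two terms of a sum over `Fin n`. -/
theorem sum_eq_add_add_sum_two_le {M : Type*} [AddCommMonoid M] {n : ℕ} (hn : 1 < n)
    (f : Fin n → M) :
    ∑ j, f j = f ⟨0, Nat.zero_lt_of_lt hn⟩ + f ⟨1, hn⟩ +
      ∑ j : {j : Fin n // 2 ≤ (j : ℕ)}, f j.1 := by
  obtain ⟨k, rfl⟩ := Nat.exists_eq_add_of_le' hn
  rw [Fin.sum_univ_succ, Fin.sum_univ_succ, ← add_assoc]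
  refine congrArg₂ _ rfl ?_
  let e : Fin k → {j : Fin (k + 2) // 2 ≤ (j : ℕ)} := fun j => ⟨j.succ.succ, by simp⟩
  have he : Function.Bijective e :=
    ⟨fun x y h => by simpa [e] using h, fun ⟨j, hj⟩ => ⟨⟨j - 2, by omega⟩, by ext; simp [e]; omega⟩⟩
  exact Fintype.sum_bijective e he _ _ fun _ => rfl

/-- with the cancellation data, `ι` is a `D`-structure morphism from
`(N̄, δ̄)` to `(N, δ)`:
`(μ ⊗ id_N) ∘ (id_A ⊗ δ) ∘ ι − (μ ⊗ id_N) ∘ (id_A ⊗ ι) ∘ δ̄ + (d ⊗ ε_N) ∘ ι = 0`.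
(Paper indices `1, 2` correspond to the Lean indices `⟨0,_⟩, ⟨1,_⟩` of `Fin n`,
and `i ≥ 3` to `2 ≤ (i : ℕ)`.) -/
theorem iota_is_D_structure_morphism
    {R A : Type*} [CommRing R] [Ring A] [Algebra R A]
    (𝒜 : ℤ → Submodule R A) [GradedAlgebra 𝒜]
    (d : A →ₗ[R] A) (hd1 : d 1 = 0)
    (hLeib : ∀ (j : ℤ) (α β : A), β ∈ 𝒜 j →
      d (α * β) = zsign j • (d α * β) + α * d β)
    (n : ℕ) (hn : 2 ≤ n) (m : Fin n → ℤ) (a : Fin n → Fin n → A)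
    (ha : ∀ i j, a i j ∈ 𝒜 (m i - m j + 1))
    (hstruct : ∀ i k, zsign (m k) • d (a i k) + ∑ j, a i j * a j k = 0)
    (haii : ∀ i, a i i = 0)
    (ha12 : a ⟨0, by omega⟩ ⟨1, by omega⟩ = 1)
    (hm : m ⟨1, by omega⟩ = m ⟨0, by omega⟩ + 1)
    (abar : Fin n → Fin n → A)
    (habar : ∀ i j, abar i j = a i j - a i ⟨1, by omega⟩ * a ⟨0, by omega⟩ j)
    (δ : (Fin n → R) →ₗ[R] A ⊗[R] (Fin n → R))
    (hδ : ∀ i, δ (Pi.basisFun R (Fin n) i) =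
      ∑ j, a i j ⊗ₜ[R] (Pi.basisFun R (Fin n) j : Fin n → R))
    (ε : (Fin n → R) →ₗ[R] (Fin n → R))
    (hε : ∀ i, ε (Pi.basisFun R (Fin n) i) =
      zsign (m i) • (Pi.basisFun R (Fin n) i : Fin n → R))
    (δbar : ({j : Fin n // 2 ≤ (j : ℕ)} → R) →ₗ[R]
        A ⊗[R] ({j : Fin n // 2 ≤ (j : ℕ)} → R))
    (hδbar : ∀ i : {j : Fin n // 2 ≤ (j : ℕ)},
      δbar (Pi.basisFun R {j : Fin n // 2 ≤ (j : ℕ)} i) =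
        ∑ j : {j : Fin n // 2 ≤ (j : ℕ)},
          abar i.1 j.1 ⊗ₜ[R]
            (Pi.basisFun R {j : Fin n // 2 ≤ (j : ℕ)} j
              : {j : Fin n // 2 ≤ (j : ℕ)} → R))
    (ι : ({j : Fin n // 2 ≤ (j : ℕ)} → R) →ₗ[R] A ⊗[R] (Fin n → R))
    (hι : ∀ i : {j : Fin n // 2 ≤ (j : ℕ)},
      ι (Pi.basisFun R {j : Fin n // 2 ≤ (j : ℕ)} i) =
        (1 : A) ⊗ₜ[R] (Pi.basisFun R (Fin n) i.1 : Fin n → R)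
          - a i.1 ⟨1, by omega⟩ ⊗ₜ[R]
              (Pi.basisFun R (Fin n) ⟨0, by omega⟩ : Fin n → R)) :
    dstar δ ι - dstar ι δbar + (TensorProduct.map d ε) ∘ₗ ι = 0 := by
  refine (Pi.basisFun R {j : Fin n // 2 ≤ (j : ℕ)}).ext fun i => ?_
  have hi := hstruct i.1 ⟨1, by omega⟩
  have h0 := hstruct ⟨0, by omega⟩ ⟨1, by omega⟩
  rw [sum_eq_add_add_sum_two_le hn, hm, zsign_add_one, ha12, haii] at hi h0
  simp only [haii, hd1, smul_zero, mul_one, mul_zero, add_zero, zero_add] at hi h0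
  have hcoeff : ∑ j : {j : Fin n // 2 ≤ (j : ℕ)}, abar i.1 j.1 * a j.1 ⟨1, by omega⟩ =
      zsign (m ⟨0, by omega⟩) • d (a i.1 ⟨1, by omega⟩) - a i.1 ⟨0, by omega⟩ := by
    simp only [habar, sub_mul, mul_assoc, Finset.sum_sub_distrib, ← Finset.mul_sum, h0,
      mul_zero, sub_zero]
    rw [neg_smul] at hi
    rw [← sub_eq_zero, ← hi]
    abel
  have hδι : dstar δ ι (Pi.basisFun R _ i) =
      ∑ j, abar i.1 j ⊗ₜ[R] (Pi.basisFun R (Fin n) j : Fin n → R) := by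
    simp only [dstar, LinearMap.comp_apply, hι, map_sub, LinearMap.lTensor_tmul, hδ, tmul_sum,
      map_sum, mu2_tmul, one_mul, habar, sub_tmul, Finset.sum_sub_distrib]
  have hιδ : dstar ι δbar (Pi.basisFun R _ i) =
      ∑ j : {j : Fin n // 2 ≤ (j : ℕ)},
          abar i.1 j.1 ⊗ₜ[R] (Pi.basisFun R (Fin n) j.1 : Fin n → R) -
        (∑ j : {j : Fin n // 2 ≤ (j : ℕ)}, abar i.1 j.1 * a j.1 ⟨1, by omega⟩) ⊗ₜ[R]
          (Pi.basisFun R (Fin n) ⟨0, by omega⟩ : Fin n → R) := by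
    simp only [dstar, LinearMap.comp_apply, hδbar, hι, map_sum, LinearMap.lTensor_tmul, tmul_sub,
      map_sub, mu2_tmul, mul_one, Finset.sum_sub_distrib, sum_tmul]
  have hdι : TensorProduct.map d ε (ι (Pi.basisFun R _ i)) =
      -((zsign (m ⟨0, by omega⟩) • d (a i.1 ⟨1, by omega⟩)) ⊗ₜ[R]
        (Pi.basisFun R (Fin n) ⟨0, by omega⟩ : Fin n → R)) := by
    rw [hι, map_sub, map_tmul, map_tmul, hd1, zero_tmul, zero_sub, hε, smul_tmul]
  rw [LinearMap.add_apply, LinearMap.sub_apply, LinearMap.comp_apply, hδι, hιδ, hdι, hcoeff,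
    sum_eq_add_add_sum_two_le hn, habar i.1 ⟨0, by omega⟩, habar i.1 ⟨1, by omega⟩, haii, ha12,
    mul_zero, mul_one, sub_zero, sub_self, zero_tmul, sub_tmul, LinearMap.zero_apply]
  abel

end
end

section
/- Cancellation with a unit coefficient: suppose (a i j) is a family of structure coefficients with a i i = 0 for all i, a 1 2 = u • 1 for some unit u of R, and m 2 = m 1 + 1. Then the reduced coefficients ā i j = a i j − u⁻¹ • (a i 2 * a 1 j), for 3 ≤ i, j ≤ n, satisfy the structure identity on the index set {3, …, n}: for all 3 ≤ i, k ≤ n, (-1)^(m k) • d (ā i k) + ∑_{j=3}^{n} (ā i j * ā j k) = 0. -/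
open TensorProduct

noncomputable section

theorem zsign_mul_zsign (i j : ℤ) : zsign i * zsign j = zsign (i + j) := by
  simp [zsign, zpow_add]

/-- cancellation with a unit coefficient: if `a i i = 0` for all `i`,
`a 1 2 = u • 1` for a unit `u` of `R`, and `m 2 = m 1 + 1`, then the reduced
coefficients `ā i j = a i j − u⁻¹ • (a i 2 * a 1 j)` satisfy the structure
identity on the index set `{3, …, n}`.
(Paper indices `1, 2` correspond to the Lean indices `⟨0,_⟩, ⟨1,_⟩` of `Fin n`,
and `j ≥ 3` to `2 ≤ (j : ℕ)`.) -/
theorem cancellation_structure_identity_unit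
    {R A : Type*} [CommRing R] [Ring A] [Algebra R A]
    (𝒜 : ℤ → Submodule R A) [GradedAlgebra 𝒜]
    (d : A →ₗ[R] A) (hd1 : d 1 = 0)
    (hLeib : ∀ (j : ℤ) (α β : A), β ∈ 𝒜 j →
      d (α * β) = zsign j • (d α * β) + α * d β)
    (n : ℕ) (hn : 2 ≤ n) (m : Fin n → ℤ) (a : Fin n → Fin n → A)
    (ha : ∀ i j, a i j ∈ 𝒜 (m i - m j + 1))
    (hstruct : ∀ i k, zsign (m k) • d (a i k) + ∑ j, a i j * a j k = 0)
    (haii : ∀ i, a i i = 0)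
    (u : Rˣ)
    (ha12 : a ⟨0, by omega⟩ ⟨1, by omega⟩ = (u : R) • (1 : A))
    (hm : m ⟨1, by omega⟩ = m ⟨0, by omega⟩ + 1)
    (abar : Fin n → Fin n → A)
    (habar : ∀ i j, abar i j =
      a i j - ((u⁻¹ : Rˣ) : R) • (a i ⟨1, by omega⟩ * a ⟨0, by omega⟩ j)) :
    ∀ i k : Fin n, 2 ≤ (i : ℕ) → 2 ≤ (k : ℕ) →
      zsign (m k) • d (abar i k)
        + ∑ j ∈ Finset.univ.filter (fun j : Fin n => 2 ≤ (j : ℕ)),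
            abar i j * abar j k = 0 := by
  intro i k _ _
  set p : Fin n := ⟨0, by omega⟩ with hp
  set q : Fin n := ⟨1, by omega⟩ with hq
  set v : R := ((u⁻¹ : Rˣ) : R) with hv
  have hvu : v * (u : R) = 1 := by simp [hv]
  have hvanish : ∀ j : Fin n, ¬ 2 ≤ (j : ℕ) → abar i j * abar j k = 0 := by
    intro j hj
    have hjpq : j = p ∨ j = q := by
      simp only [hp, hq, Fin.ext_iff]
      omega
    rcases hjpq with rfl | rfl
    · simp [habar p k, ha12, smul_smul, hvu]
    · simp [habar i q, ha12, smul_smul, hvu]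
  have hsum : ∑ j ∈ Finset.univ.filter (fun j : Fin n => 2 ≤ (j : ℕ)), abar i j * abar j k
      = ∑ j, abar i j * abar j k := by
    refine Finset.sum_subset (Finset.subset_univ _) fun j _ hj => hvanish j ?_
    simpa using hj
  have hexpand : ∑ j, abar i j * abar j k
      = ∑ j, a i j * a j k - v • ((∑ j, a i j * a j q) * a p k)
        - v • (a i q * ∑ j, a p j * a j k)
        + (v * v) • (a i q * (∑ j, a p j * a j q) * a p k) := by
    simp only [Finset.sum_mul, Finset.mul_sum, Finset.smul_sum, ← Finset.sum_sub_distrib,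
      ← Finset.sum_add_distrib]
    refine Finset.sum_congr rfl fun j _ => ?_
    simp only [habar, sub_mul, mul_sub, smul_sub, smul_mul_assoc, mul_smul_comm, smul_smul,
      mul_assoc]
    abel
  have hS : ∀ i k, ∑ j, a i j * a j k = -(zsign (m k) • d (a i k)) :=
    fun i k => eq_neg_of_add_eq_zero_right (hstruct i k)
  have hsign : zsign (m k) * zsign (m p - m k + 1) = zsign (m q) := by
    rw [zsign_mul_zsign, hm]
    congr 1
    ring
  rw [hsum, hexpand, hS, hS, hS, hS, ha12, habar, map_sub, map_smul, map_smul, hd1,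
    hLeib _ _ _ (ha p k), smul_sub, smul_comm (zsign (m k)) v, smul_add (zsign (m k)), smul_smul,
    hsign]
  simp only [smul_zero, neg_zero, mul_zero, zero_mul, add_zero, neg_mul, mul_neg, smul_neg,
    smul_mul_assoc, mul_smul_comm, smul_add]
  abel

end
end

section
/- Composition of D-structure morphisms is a D-structure morphism: let N, N', N'' be free R-modules with finite bases (x i), (y p), (z r) and integer degree functions m, m', m'', and let δ : N → A ⊗[R] N, δ' : N' → A ⊗[R] N', δ'' : N'' → A ⊗[R] N'' be R-linear maps. If ψ : N → A ⊗[R] N' is a D-structure morphism from (N, δ) to (N', δ'), and φ : N' → A ⊗[R] N'' is a D-structure morphism from (N', δ') to (N'', δ'') whose coefficients f p r lie in 𝒜 (m' p − m'' r) for all p, r, then φ ∗ ψ is a D-structure morphism from (N, δ) to (N'', δ''). -/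
open TensorProduct

noncomputable section

section

variable {R A : Type*} [CommRing R] [Ring A] [Algebra R A]

section

variable {M : Type*} [AddCommGroup M] [Module R M]

@[simp]
theorem mu2_tmul_s9 (a b : A) (x : M) :
    mu2 R A M (a ⊗ₜ[R] (b ⊗ₜ[R] x)) = (a * b) ⊗ₜ[R] x := by
  simp [mu2]

theorem mu2_tmul_mu2 (a : A) (t : A ⊗[R] (A ⊗[R] M)) :
    mu2 R A M (a ⊗ₜ[R] mu2 R A M t) =
      mu2 R A M (mu2 R A (A ⊗[R] M) (a ⊗ₜ[R] t)) := by
  induction t with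
  | zero => simp
  | add s t hs ht => simp only [map_add, tmul_add, hs, ht]
  | tmul b u =>
    induction u with
    | zero => simp
    | add s t hs ht => simp only [map_add, tmul_add, hs, ht]
    | tmul c x => simp [mul_assoc]

end

variable {M₁ M₂ M₃ M₄ : Type*} [AddCommGroup M₁] [Module R M₁]
  [AddCommGroup M₂] [Module R M₂] [AddCommGroup M₃] [Module R M₃]
  [AddCommGroup M₄] [Module R M₄]

theorem lTensor_mu2 (f : M₂ →ₗ[R] A ⊗[R] M₃) (t : A ⊗[R] (A ⊗[R] M₂)) :
    f.lTensor A (mu2 R A M₂ t) =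
      mu2 R A (A ⊗[R] M₃) ((f.lTensor A).lTensor A t) := by
  induction t with
  | zero => simp
  | add s t hs ht => simp only [map_add, hs, ht]
  | tmul a u =>
    induction u with
    | zero => simp
    | add s t hs ht => simp only [map_add, tmul_add, hs, ht]
    | tmul b x => simp

theorem dstar_assoc (h : M₃ →ₗ[R] A ⊗[R] M₄) (f : M₂ →ₗ[R] A ⊗[R] M₃)
    (g : M₁ →ₗ[R] A ⊗[R] M₂) :
    dstar h (dstar f g) = dstar (dstar h f) g := by
  ext x
  simp only [dstar, LinearMap.comp_apply]
  rw [lTensor_mu2]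
  induction g x with
  | zero => simp
  | add s t hs ht => simp only [map_add, hs, ht]
  | tmul a y => simp [mu2_tmul_mu2]

theorem dstar_add_left (f f' : M₂ →ₗ[R] A ⊗[R] M₃) (g : M₁ →ₗ[R] A ⊗[R] M₂) :
    dstar (f + f') g = dstar f g + dstar f' g := by
  simp [dstar, LinearMap.lTensor_add, LinearMap.add_comp, LinearMap.comp_add]

theorem dstar_add_right (f : M₂ →ₗ[R] A ⊗[R] M₃) (g g' : M₁ →ₗ[R] A ⊗[R] M₂) :
    dstar f (g + g') = dstar f g + dstar f g' := by
  simp [dstar, LinearMap.comp_add]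

/-- The Leibniz rule for the composition with a map whose coefficients are homogeneous. -/
theorem map_comp_dstar (𝒜 : ℤ → Submodule R A) (d : A →ₗ[R] A)
    (hLeib : ∀ (j : ℤ) (α β : A), β ∈ 𝒜 j →
      d (α * β) = zsign j • (d α * β) + α * d β)
    {κ κ' : Type*} [Fintype κ'] (b : Module.Basis κ R M₂) (c : κ' → M₃)
    (m : κ → ℤ) (m' : κ' → ℤ)
    (ε : M₂ →ₗ[R] M₂) (hε : ∀ p, ε (b p) = zsign (m p) • b p)
    (ε' : M₃ →ₗ[R] M₃) (hε' : ∀ r, ε' (c r) = zsign (m' r) • c r)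
    (φ : M₂ →ₗ[R] A ⊗[R] M₃) (f : κ → κ' → A)
    (hf : ∀ p, φ (b p) = ∑ r, f p r ⊗ₜ[R] c r)
    (hfdeg : ∀ p r, f p r ∈ 𝒜 (m p - m' r))
    (ψ : M₁ →ₗ[R] A ⊗[R] M₂) :
    TensorProduct.map d ε' ∘ₗ dstar φ ψ =
      dstar φ (TensorProduct.map d ε ∘ₗ ψ) + dstar (TensorProduct.map d ε' ∘ₗ φ) ψ := by
  suffices h : TensorProduct.map d ε' ∘ₗ mu2 R A M₃ ∘ₗ φ.lTensor A =
      mu2 R A M₃ ∘ₗ φ.lTensor A ∘ₗ TensorProduct.map d ε +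
        mu2 R A M₃ ∘ₗ (TensorProduct.map d ε' ∘ₗ φ).lTensor A by
    simpa only [dstar, LinearMap.comp_assoc, LinearMap.add_comp] using
      congrArg (fun F => F ∘ₗ ψ) h
  refine TensorProduct.ext (LinearMap.ext fun a => b.ext fun p => ?_)
  simp only [LinearMap.compr₂ₛₗ_apply, TensorProduct.mk_apply, LinearMap.add_apply,
    LinearMap.comp_apply, LinearMap.lTensor_tmul, TensorProduct.map_tmul, hε, hf, map_sum,
    map_zsmul, tmul_sum, hε', mu2_tmul_s9, tmul_smul, Finset.smul_sum, ← Finset.sum_add_distrib]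
  refine Finset.sum_congr rfl fun r _ => ?_
  have hsign : zsign (m p) = zsign (m' r) * zsign (m p - m' r) := by
    rw [← zsign_add]; congr 1; ring
  rw [hLeib _ _ _ (hfdeg p r), add_tmul, smul_add, hsign, mul_smul, ← smul_tmul']

end

/-- the composition of `D`-structure morphisms is a `D`-structure
morphism: if `ψ` is a `D`-structure morphism from `(N, δ)` to `(N', δ')` and `φ`
is a `D`-structure morphism from `(N', δ')` to `(N'', δ'')` whose coefficients
`f p r` lie in `𝒜 (m' p − m'' r)`, then `φ ∗ ψ` is a `D`-structure morphism from
`(N, δ)` to `(N'', δ'')`. -/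
theorem comp_is_D_structure_morphism
    {R A : Type*} [CommRing R] [Ring A] [Algebra R A]
    (𝒜 : ℤ → Submodule R A) [GradedAlgebra 𝒜]
    (d : A →ₗ[R] A) (hd1 : d 1 = 0)
    (hLeib : ∀ (j : ℤ) (α β : A), β ∈ 𝒜 j →
      d (α * β) = zsign j • (d α * β) + α * d β)
    {ι ι' ι'' : Type*} [Fintype ι] [DecidableEq ι] [Fintype ι'] [DecidableEq ι']
    [Fintype ι''] [DecidableEq ι'']
    (m : ι → ℤ) (m' : ι' → ℤ) (m'' : ι'' → ℤ)
    (δ : (ι → R) →ₗ[R] A ⊗[R] (ι → R))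
    (δ' : (ι' → R) →ₗ[R] A ⊗[R] (ι' → R))
    (δ'' : (ι'' → R) →ₗ[R] A ⊗[R] (ι'' → R))
    (ε' : (ι' → R) →ₗ[R] (ι' → R))
    (hε' : ∀ p, ε' (Pi.basisFun R ι' p) =
      zsign (m' p) • (Pi.basisFun R ι' p : ι' → R))
    (ε'' : (ι'' → R) →ₗ[R] (ι'' → R))
    (hε'' : ∀ r, ε'' (Pi.basisFun R ι'' r) =
      zsign (m'' r) • (Pi.basisFun R ι'' r : ι'' → R))
    (ψ : (ι → R) →ₗ[R] A ⊗[R] (ι' → R))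
    (hψ : dstar δ' ψ - dstar ψ δ + (TensorProduct.map d ε') ∘ₗ ψ = 0)
    (φ : (ι' → R) →ₗ[R] A ⊗[R] (ι'' → R))
    (hφ : dstar δ'' φ - dstar φ δ' + (TensorProduct.map d ε'') ∘ₗ φ = 0)
    (f : ι' → ι'' → A)
    (hf : ∀ p, φ (Pi.basisFun R ι' p) =
      ∑ r, f p r ⊗ₜ[R] (Pi.basisFun R ι'' r : ι'' → R))
    (hfdeg : ∀ p r, f p r ∈ 𝒜 (m' p - m'' r)) :
    dstar δ'' (dstar φ ψ) - dstar (dstar φ ψ) δ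
      + (TensorProduct.map d ε'') ∘ₗ dstar φ ψ = 0 := by
  have hL := map_comp_dstar 𝒜 d hLeib (Pi.basisFun R ι') (Pi.basisFun R ι'') m' m''
    ε' hε' ε'' hε'' φ f hf hfdeg ψ
  have h₁ : dstar δ'' φ + TensorProduct.map d ε'' ∘ₗ φ = dstar φ δ' := by
    rw [← sub_eq_zero, ← hφ]; abel
  have h₂ : dstar δ' ψ + TensorProduct.map d ε' ∘ₗ ψ = dstar ψ δ := by
    rw [← sub_eq_zero, ← hψ]; abel
  rw [hL, dstar_assoc, ← dstar_assoc φ ψ δ, ← h₂, dstar_add_right, dstar_assoc φ δ' ψ, ← h₁,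
    dstar_add_left]
  abel

end
end
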